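/- arXiv:1710.09764 — 6 statements merged into one kernel-verified Lean document; each statement's English description precedes it below -/
import Mathlib

section
/- Let θ be an atomless real random variable with cdf F_θ, let Θ ∈ (0, π/2], Φ ≥ 0, and c₁, c₂ > 0. Set θ₁ := θ, θ₂ := Φ − θ, and define the square effective channel H := max(c₁·cos²(θ₁)·𝟙{|θ₁| ≤ Θ}, c₂·cos²(θ₂)·𝟙{|θ₂| ≤ Θ}). Then for every x with 0 < x < min(c₁, c₂), writing z₁ := (1/2)·arccos(2x/c₁ − 1) and z₂ := (1/2)·arccos(2x/c₂ − 1), one has 𝒫(H ≤ x) = P₁ + P₂ + P₃ + P₄, where P₁ = ∇(−Θ, −z₁, Φ−Θ, Φ−z₂) + ∇(z₁, Θ, max(0, Φ−Θ), Φ−z₂) + ∇(z₁, Θ, Φ+z₂, Φ+Θ), P₂ = Δ(−Θ, min(−z₁, Φ−Θ)) + Δ(z₁, min(Θ, Φ−Θ)), P₃ = ∇(Φ−Θ, Φ−z₂, Θ, Φ) + Δ(max(Φ+z₂, Θ), Φ+Θ), and P₄ = Δ(Θ, Φ−Θ) + F_θ(−Θ) + 1 − F_θ(Φ+Θ). [Theorem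 1, cdf part] -/
open MeasureTheory

/-- `Δ(a,b) = F b - F a` if `a ≤ b`, else `0`. -/
noncomputable def Delta (F : ℝ → ℝ) (a b : ℝ) : ℝ := if a ≤ b then F b - F a else 0

/-- `∇(a,b,c,d) = F (min b d) - F (max a c)` if `a ≤ b`, `c ≤ d` and
`max a c ≤ min b d`, else `0`. -/
noncomputable def Nabla (F : ℝ → ℝ) (a b c d : ℝ) : ℝ :=
  if a ≤ b ∧ c ≤ d ∧ max a c ≤ min b d then F (min b d) - F (max a c) else 0

lemma nabla_eq (F : ℝ → ℝ) (a b c d : ℝ) : Nabla F a b c d = Delta F (max a c) (min b d) := by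
  unfold Nabla Delta
  have : (a ≤ b ∧ c ≤ d ∧ max a c ≤ min b d) ↔ max a c ≤ min b d := by
    constructor
    · exact fun h => h.2.2
    · intro h
      have h' := h
      simp only [max_le_iff, le_min_iff] at h'
      exact ⟨h'.1.1, h'.2.2, h⟩
  simp only [this]

lemma cos_le (c x t : ℝ) (hx : 0 < x) (hc : x < c) (ht : |t| ≤ Real.pi / 2) :
    c * Real.cos t ^ 2 ≤ x ↔ (1 / 2) * Real.arccos (2 * x / c - 1) ≤ |t| := by
  have hc0 : 0 < c := hx.trans hc
  have h0 := abs_nonneg t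
  have e : Real.arccos (Real.cos (2 * |t|)) = 2 * |t| :=
    Real.arccos_cos (by linarith) (by linarith)
  have e2 : Real.cos (2 * |t|) = 2 * Real.cos t ^ 2 - 1 := by
    rw [Real.cos_two_mul, Real.cos_abs]
  have hxc : 2 * x / c ≤ 2 := by rw [div_le_iff₀ hc0]; linarith
  have hxc0 : 0 ≤ 2 * x / c := by positivity
  have k : (1 / 2) * Real.arccos (2 * x / c - 1) ≤ |t| ↔
      Real.arccos (2 * x / c - 1) ≤ Real.arccos (Real.cos (2 * |t|)) := by
    rw [e]; constructor <;> intro h <;> linarith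
  rw [k, Real.strictAntiOn_arccos.le_iff_ge ⟨by linarith, by linarith⟩
    ⟨Real.neg_one_le_cos _, Real.cos_le_one _⟩, e2]
  constructor
  · intro h
    have : 2 * Real.cos t ^ 2 ≤ 2 * x / c := by rw [le_div_iff₀ hc0]; linarith
    linarith
  · intro h
    have : 2 * Real.cos t ^ 2 ≤ 2 * x / c := by linarith
    rw [le_div_iff₀ hc0] at this; linarith

lemma z_pos (c x : ℝ) (hx : 0 < x) (hc : x < c) :
    0 < (1 / 2) * Real.arccos (2 * x / c - 1) := by
  have hc0 : 0 < c := hx.trans hc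
  have : 2 * x / c < 2 := by rw [div_lt_iff₀ hc0]; linarith
  have := Real.arccos_pos.2 (show 2 * x / c - 1 < 1 by linarith)
  linarith

lemma term_le (c x t Θ : ℝ) (hx : 0 < x) (hc : x < c) (hΘ : Θ ≤ Real.pi / 2) :
    c * Real.cos t ^ 2 * (if |t| ≤ Θ then 1 else 0) ≤ x ↔
      (|t| ≤ Θ → (1 / 2) * Real.arccos (2 * x / c - 1) ≤ |t|) := by
  split_ifs with h
  · rw [mul_one, cos_le c x t hx hc (h.trans hΘ)]; simp [h]
  · simp [h, hx.le]

lemma delta_eq {Ω : Type*} [MeasurableSpace Ω] (ℙ : Measure Ω) [IsProbabilityMeasure ℙ]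
    (θ : Ω → ℝ) (hθ : Measurable θ) (hatomless : ∀ t : ℝ, ℙ {ω | θ ω = t} = 0)
    (F : ℝ → ℝ) (hF : ∀ t : ℝ, F t = (ℙ {ω | θ ω ≤ t}).toReal) (a b : ℝ) :
    Delta F a b = ℙ.real (θ ⁻¹' Set.Ioo a b) := by
  unfold Delta
  split_ifs with h
  · have h1 : ℙ.real (θ ⁻¹' Set.Ioo a b) = ℙ.real (θ ⁻¹' Set.Ioc a b) := by
      apply measureReal_congr
      have : ∀ᵐ ω ∂ℙ, θ ω ≠ b := by
        rw [ae_iff]; simpa using hatomless b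
      filter_upwards [this] with ω hω
      apply propext
      change (a < θ ω ∧ θ ω < b) ↔ (a < θ ω ∧ θ ω ≤ b)
      rw [lt_iff_le_and_ne (b := b)]; tauto
    have h2 : θ ⁻¹' Set.Ioc a b = {ω | θ ω ≤ b} \ {ω | θ ω ≤ a} := by
      ext ω; simp [and_comm]
    have h3 : {ω | θ ω ≤ a} ⊆ {ω | θ ω ≤ b} := fun ω hω => le_trans hω h
    rw [h1, h2, measureReal_sdiff h3
      (measurableSet_le hθ measurable_const), hF, hF]; rfl
  · rw [Set.Ioo_eq_empty (by intro h'; exact h h'.le)]; simp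

lemma pointwise (t Θ Φ z₁ z₂ : ℝ) (hΘ : 0 < Θ) (hΦ : 0 ≤ Φ) (h1 : 0 < z₁) (h2 : 0 < z₂)
    (n1 : t ≠ Θ) (n2 : t ≠ -Θ) (n3 : t ≠ z₁) (n4 : t ≠ -z₁) (n5 : t ≠ Φ - Θ) (n6 : t ≠ Φ + Θ)
    (n7 : t ≠ Φ - z₂) (n8 : t ≠ Φ + z₂) :
    (if (|t| ≤ Θ → z₁ ≤ |t|) ∧ (|Φ - t| ≤ Θ → z₂ ≤ |Φ - t|) then (1 : ℝ) else 0) =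
    ((if max (-Θ) (Φ - Θ) < t ∧ t < min (-z₁) (Φ - z₂) then 1 else 0)
      + (if max z₁ (max 0 (Φ - Θ)) < t ∧ t < min Θ (Φ - z₂) then 1 else 0)
      + (if max z₁ (Φ + z₂) < t ∧ t < min Θ (Φ + Θ) then 1 else 0))
    + ((if -Θ < t ∧ t < min (-z₁) (Φ - Θ) then 1 else 0)
      + (if z₁ < t ∧ t < min Θ (Φ - Θ) then 1 else 0))
    + ((if max (Φ - Θ) Θ < t ∧ t < min (Φ - z₂) Φ then 1 else 0)
      + (if max (Φ + z₂) Θ < t ∧ t < Φ + Θ then 1 else 0))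
    + ((if Θ < t ∧ t < Φ - Θ then 1 else 0) + (if t < -Θ then 1 else 0)
      + (if Φ + Θ < t then 1 else 0)) := by
  simp only [max_lt_iff, lt_min_iff, abs_le, le_abs]
  rcases lt_or_gt_of_ne n1 with a1 | a1 <;> rcases lt_or_gt_of_ne n2 with a2 | a2 <;>
  rcases lt_or_gt_of_ne n5 with a5 | a5 <;> rcases lt_or_gt_of_ne n6 with a6 | a6 <;>
  first
  | (exfalso; linarith)
  | (rcases lt_or_gt_of_ne n3 with a3 | a3 <;> rcases lt_or_gt_of_ne n4 with a4 | a4 <;>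
      rcases lt_or_gt_of_ne n7 with a7 | a7 <;> rcases lt_or_gt_of_ne n8 with a8 | a8 <;>
      first
      | (exfalso; linarith)
      | grind)

/-- **Theorem 1 (cdf part).** The cdf of the square effective channel of the two-LED
setting decomposes as `P₁ + P₂ + P₃ + P₄`. -/
theorem stmt_1 {Ω : Type*} [MeasurableSpace Ω] (ℙ : Measure Ω) [IsProbabilityMeasure ℙ]
    (θ : Ω → ℝ) (hθ : Measurable θ)
    (hatomless : ∀ t : ℝ, ℙ {ω | θ ω = t} = 0)
    (F : ℝ → ℝ) (hF : ∀ t : ℝ, F t = (ℙ {ω | θ ω ≤ t}).toReal)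
    (Θ Φ c₁ c₂ : ℝ) (hΘ₀ : 0 < Θ) (hΘ₁ : Θ ≤ Real.pi / 2) (hΦ : 0 ≤ Φ)
    (hc₁ : 0 < c₁) (hc₂ : 0 < c₂)
    (H : Ω → ℝ)
    (hH : ∀ ω, H ω =
      max (c₁ * Real.cos (θ ω) ^ 2 * (if |θ ω| ≤ Θ then 1 else 0))
          (c₂ * Real.cos (Φ - θ ω) ^ 2 * (if |Φ - θ ω| ≤ Θ then 1 else 0)))
    (x : ℝ) (hx₀ : 0 < x) (hx₁ : x < min c₁ c₂)
    (z₁ z₂ : ℝ)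
    (hz₁ : z₁ = (1 / 2) * Real.arccos (2 * x / c₁ - 1))
    (hz₂ : z₂ = (1 / 2) * Real.arccos (2 * x / c₂ - 1)) :
    (ℙ {ω | H ω ≤ x}).toReal =
      (Nabla F (-Θ) (-z₁) (Φ - Θ) (Φ - z₂)
        + Nabla F z₁ Θ (max 0 (Φ - Θ)) (Φ - z₂)
        + Nabla F z₁ Θ (Φ + z₂) (Φ + Θ))
      + (Delta F (-Θ) (min (-z₁) (Φ - Θ))
        + Delta F z₁ (min Θ (Φ - Θ)))
      + (Nabla F (Φ - Θ) (Φ - z₂) Θ Φ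
        + Delta F (max (Φ + z₂) Θ) (Φ + Θ))
      + (Delta F Θ (Φ - Θ) + F (-Θ) + 1 - F (Φ + Θ)) := by
  have hxc₁ : x < c₁ := hx₁.trans_le (min_le_left _ _)
  have hxc₂ : x < c₂ := hx₁.trans_le (min_le_right _ _)
  have hz₁p : 0 < z₁ := hz₁ ▸ z_pos c₁ x hx₀ hxc₁
  have hz₂p : 0 < z₂ := hz₂ ▸ z_pos c₂ x hx₀ hxc₂
  have hset : {ω | H ω ≤ x} =
      θ ⁻¹' {t | (|t| ≤ Θ → z₁ ≤ |t|) ∧ (|Φ - t| ≤ Θ → z₂ ≤ |Φ - t|)} := by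
    ext ω
    simp only [Set.mem_ofPred_eq, Set.mem_preimage]
    rw [hH, max_le_iff, term_le c₁ x _ Θ hx₀ hxc₁ hΘ₁, term_le c₂ x _ Θ hx₀ hxc₂ hΘ₁, hz₁, hz₂]
  have hD := delta_eq ℙ θ hθ hatomless F hF
  have hne : ∀ b : ℝ, ∀ᵐ ω ∂ℙ, θ ω ≠ b := by
    intro b; rw [ae_iff]; simpa using hatomless b
  have hlo : F (-Θ) = ℙ.real (θ ⁻¹' Set.Iio (-Θ)) := by
    rw [hF]
    apply measureReal_congr
    filter_upwards [hne (-Θ)] with ω hω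
    apply propext
    change θ ω ≤ -Θ ↔ θ ω < -Θ
    exact ⟨fun h => lt_of_le_of_ne h hω, le_of_lt⟩
  have hhi : 1 - F (Φ + Θ) = ℙ.real (θ ⁻¹' Set.Ioi (Φ + Θ)) := by
    have : θ ⁻¹' Set.Ioi (Φ + Θ) = {ω | θ ω ≤ Φ + Θ}ᶜ := by ext ω; simp
    rw [this, probReal_compl_eq_one_sub (measurableSet_le hθ measurable_const), hF]; rfl
  have hms : MeasurableSet {t : ℝ | (|t| ≤ Θ → z₁ ≤ |t|) ∧ (|Φ - t| ≤ Θ → z₂ ≤ |Φ - t|)} := by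
    have e : {t : ℝ | (|t| ≤ Θ → z₁ ≤ |t|) ∧ (|Φ - t| ≤ Θ → z₂ ≤ |Φ - t|)} =
        ({t : ℝ | |t| ≤ Θ}ᶜ ∪ {t : ℝ | z₁ ≤ |t|}) ∩
        ({t : ℝ | |Φ - t| ≤ Θ}ᶜ ∪ {t : ℝ | z₂ ≤ |Φ - t|}) := by
      ext t; simp only [Set.mem_ofPred_eq, Set.mem_inter_iff, Set.mem_union, Set.mem_compl_iff]
      tauto
    rw [e]
    refine MeasurableSet.inter (.union (.compl ?_) ?_) (.union (.compl ?_) ?_) <;>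
      exact measurableSet_le (by fun_prop) (by fun_prop)
  have hI : ∀ s : Set ℝ, MeasurableSet s →
      ℙ.real (θ ⁻¹' s) = ∫ ω, s.indicator (fun _ => (1 : ℝ)) (θ ω) ∂ℙ := by
    intro s hs
    exact (integral_indicator_one (hθ hs)).symm
  have hint : ∀ s : Set ℝ, MeasurableSet s →
      Integrable (fun ω => s.indicator (fun _ => (1 : ℝ)) (θ ω)) ℙ := by
    intro s hs
    exact (integrable_const (1 : ℝ)).indicator (hθ hs)
  have hio : ∀ a b : ℝ, Integrable (fun ω => (Set.Ioo a b).indicator (fun _ => (1 : ℝ)) (θ ω)) ℙ :=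
    fun a b => hint _ measurableSet_Ioo
  have hil := hint (Set.Iio (-Θ)) measurableSet_Iio
  have hig := hint (Set.Ioi (Φ + Θ)) measurableSet_Ioi
  rw [add_sub_assoc, hhi, hlo, hset]
  simp only [nabla_eq, hD]
  change ℙ.real _ = _
  rw [hI _ hms, hI _ measurableSet_Iio, hI _ measurableSet_Ioi]
  simp only [fun a b : ℝ => hI (Set.Ioo a b) measurableSet_Ioo]
  repeat rw [← integral_add (by fun_prop) (by fun_prop)]
  apply integral_congr_ae
  filter_upwards [hne Θ, hne (-Θ), hne z₁, hne (-z₁), hne (Φ - Θ), hne (Φ + Θ), hne (Φ - z₂),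
    hne (Φ + z₂)] with ω n1 n2 n3 n4 n5 n6 n7 n8
  have := pointwise (θ ω) Θ Φ z₁ z₂ hΘ₀ hΦ hz₁p hz₂p n1 n2 n3 n4 n5 n6 n7 n8
  simp only [Set.indicator, Set.mem_ofPred_eq, Set.mem_Ioo, Set.mem_Iio, Set.mem_Ioi]
  convert this
end

section
/- Let θ be an atomless real random variable with cdf F_θ, let Θ > 0, Φ ≥ 0, and let z₁, z₂ be reals with 0 ≤ z₁ ≤ Θ and 0 ≤ z₂ ≤ Θ. Then 𝒫(z₁ < |θ| ≤ Θ and z₂ < |Φ − θ| ≤ Θ) = ∇(−Θ, −z₁, Φ−Θ, Φ−z₂) + ∇(z₁, Θ, max(0, Φ−Θ), Φ−z₂) + ∇(z₁, Θ, Φ+z₂, Φ+Θ). [Appendix B, Case 1: formula for P₁] -/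
open MeasureTheory

theorem nabla_eq_s2 {Ω : Type*} [MeasurableSpace Ω] (ℙ : Measure Ω) [IsProbabilityMeasure ℙ]
    (θ : Ω → ℝ) (hθ : Measurable θ)
    (F : ℝ → ℝ) (hF : ∀ t : ℝ, F t = (ℙ {ω | θ ω ≤ t}).toReal) (a b c d : ℝ) :
    Nabla F a b c d = ℙ.real (θ ⁻¹' Set.Ioc (max a c) (min b d)) := by
  unfold Nabla
  split_ifs with h
  · have h1 : θ ⁻¹' Set.Ioc (max a c) (min b d)
        = {ω | θ ω ≤ min b d} \ {ω | θ ω ≤ max a c} := by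
      ext ω
      simp only [Set.mem_preimage, Set.mem_Ioc, Set.mem_sdiff, Set.mem_ofPred_eq, not_le]
      tauto
    have h2 : {ω | θ ω ≤ max a c} ⊆ {ω | θ ω ≤ min b d} := fun ω hω => le_trans hω h.2.2
    rw [h1, measureReal_sdiff h2 (measurableSet_le hθ measurable_const), hF, hF]
    rfl
  · have h1 : Set.Ioc (max a c) (min b d) = ∅ := by
      apply Set.Ioc_eq_empty
      intro h2
      apply h
      have := h2
      simp only [max_lt_iff, lt_min_iff] at this
      exact ⟨this.1.1.le, this.2.2.le, h2.le⟩
    simp [h1]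

/-- **Appendix B, Case 1.** Formula for `P₁`. -/
theorem stmt_2 {Ω : Type*} [MeasurableSpace Ω] (ℙ : Measure Ω) [IsProbabilityMeasure ℙ]
    (θ : Ω → ℝ) (hθ : Measurable θ)
    (hatomless : ∀ t : ℝ, ℙ {ω | θ ω = t} = 0)
    (F : ℝ → ℝ) (hF : ∀ t : ℝ, F t = (ℙ {ω | θ ω ≤ t}).toReal)
    (Θ Φ z₁ z₂ : ℝ) (hΘ : 0 < Θ) (hΦ : 0 ≤ Φ)
    (hz₁₀ : 0 ≤ z₁) (hz₁₁ : z₁ ≤ Θ) (hz₂₀ : 0 ≤ z₂) (hz₂₁ : z₂ ≤ Θ) :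
    (ℙ {ω | (z₁ < |θ ω| ∧ |θ ω| ≤ Θ) ∧ (z₂ < |Φ - θ ω| ∧ |Φ - θ ω| ≤ Θ)}).toReal =
      Nabla F (-Θ) (-z₁) (Φ - Θ) (Φ - z₂)
        + Nabla F z₁ Θ (max 0 (Φ - Θ)) (Φ - z₂)
        + Nabla F z₁ Θ (Φ + z₂) (Φ + Θ) := by
  rw [nabla_eq_s2 ℙ θ hθ F hF, nabla_eq_s2 ℙ θ hθ F hF, nabla_eq_s2 ℙ θ hθ F hF]
  rw [← measureReal_union _ (hθ measurableSet_Ioc), ← measureReal_union _ (hθ measurableSet_Ioc)]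
  · have hne : ∀ t : ℝ, ∀ᵐ ω ∂ℙ, θ ω ≠ t := by
      intro t
      rw [ae_iff]
      simpa using hatomless t
    rw [measureReal_def]
    congr 1
    apply measure_congr
    filter_upwards [hne (-Θ), hne (-z₁), hne (Φ - Θ), hne (Φ - z₂)] with ω h1 h2 h3 h4
    apply propext
    change ((z₁ < |θ ω| ∧ |θ ω| ≤ Θ) ∧ (z₂ < |Φ - θ ω| ∧ |Φ - θ ω| ≤ Θ)) ↔
      ((max (-Θ) (Φ - Θ) < θ ω ∧ θ ω ≤ min (-z₁) (Φ - z₂)) ∨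
       (max z₁ (max 0 (Φ - Θ)) < θ ω ∧ θ ω ≤ min Θ (Φ - z₂))) ∨
       (max z₁ (Φ + z₂) < θ ω ∧ θ ω ≤ min Θ (Φ + Θ))
    generalize θ ω = x at *
    simp only [max_lt_iff, le_min_iff, lt_abs, abs_le]
    have g1 := lt_or_gt_of_ne h1
    have g2 := lt_or_gt_of_ne h2
    have g3 := lt_or_gt_of_ne h3
    have g4 := lt_or_gt_of_ne h4
    clear hne hatomless hF h1 h2 h3 h4
    grind
  all_goals
    rw [Set.disjoint_left]
    intro ω
    simp only [Set.mem_union, Set.mem_preimage, Set.mem_Ioc, max_lt_iff, le_min_iff]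
    grind
end

section
/- Let θ be an atomless real random variable with cdf F_θ, let Θ > 0, Φ ≥ 0, and let z₁ be a real with 0 ≤ z₁ ≤ Θ. Then 𝒫(z₁ < |θ| ≤ Θ and |Φ − θ| > Θ) = Δ(−Θ, min(−z₁, Φ−Θ)) + Δ(z₁, min(Θ, Φ−Θ)). [Appendix B, Case 2: formula for P₂] -/
open MeasureTheory

theorem Delta_eq_aux {Ω : Type*} [MeasurableSpace Ω] (ℙ : Measure Ω) [IsProbabilityMeasure ℙ]
    (θ : Ω → ℝ) (hθ : Measurable θ)
    (F : ℝ → ℝ) (hF : ∀ t : ℝ, F t = (ℙ {ω | θ ω ≤ t}).toReal) (a b : ℝ) :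
    Delta F a b = (ℙ (θ ⁻¹' Set.Ioc a b)).toReal := by
  unfold Delta
  split_ifs with h
  · have h1 : θ ⁻¹' Set.Ioc a b = {ω | θ ω ≤ b} \ {ω | θ ω ≤ a} := by
      ext ω
      simp only [Set.mem_preimage, Set.mem_Ioc, Set.mem_diff, Set.mem_setOf_eq, not_le]
      tauto
    have hm : MeasurableSet {ω | θ ω ≤ a} := measurableSet_le hθ measurable_const
    have hs : {ω | θ ω ≤ a} ⊆ {ω | θ ω ≤ b} := fun ω hω => le_trans hω h
    rw [h1, hF, hF]
    exact (measureReal_diff hs hm).symm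
  · rw [Set.Ioc_eq_empty (fun h' => h h'.le)]
    simp

/-- **Appendix B, Case 2.** Formula for `P₂`. -/
theorem stmt_3 {Ω : Type*} [MeasurableSpace Ω] (ℙ : Measure Ω) [IsProbabilityMeasure ℙ]
    (θ : Ω → ℝ) (hθ : Measurable θ)
    (hatomless : ∀ t : ℝ, ℙ {ω | θ ω = t} = 0)
    (F : ℝ → ℝ) (hF : ∀ t : ℝ, F t = (ℙ {ω | θ ω ≤ t}).toReal)
    (Θ Φ z₁ : ℝ) (hΘ : 0 < Θ) (hΦ : 0 ≤ Φ)
    (hz₁₀ : 0 ≤ z₁) (hz₁₁ : z₁ ≤ Θ) :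
    (ℙ {ω | (z₁ < |θ ω| ∧ |θ ω| ≤ Θ) ∧ Θ < |Φ - θ ω|}).toReal =
      Delta F (-Θ) (min (-z₁) (Φ - Θ)) + Delta F z₁ (min Θ (Φ - Θ)) := by
  rw [Delta_eq_aux ℙ θ hθ F hF, Delta_eq_aux ℙ θ hθ F hF]
  have hd : Disjoint (θ ⁻¹' Set.Ioc (-Θ) (min (-z₁) (Φ - Θ)))
      (θ ⁻¹' Set.Ioc z₁ (min Θ (Φ - Θ))) := by
    rw [Set.disjoint_left]
    rintro ω ⟨_, h2⟩ ⟨h3, _⟩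
    have := h2.trans (min_le_left _ _)
    linarith
  have hu := measureReal_union (μ := ℙ) hd (hθ measurableSet_Ioc)
  refine Eq.trans ?_ hu
  unfold Measure.real
  congr 1
  apply measure_congr
  have e (t : ℝ) : ∀ᵐ ω ∂ℙ, θ ω ≠ t := by
    rw [ae_iff]
    simpa using hatomless t
  filter_upwards [e (-Θ), e (-z₁), e (Φ - Θ)] with ω h1 h2 h3
  apply propext
  change ((z₁ < |θ ω| ∧ |θ ω| ≤ Θ) ∧ Θ < |Φ - θ ω|) ↔
    ((-Θ < θ ω ∧ θ ω ≤ min (-z₁) (Φ - Θ)) ∨ (z₁ < θ ω ∧ θ ω ≤ min Θ (Φ - Θ)))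
  rw [lt_abs, abs_le, lt_abs, le_min_iff, le_min_iff]
  constructor
  · rintro ⟨⟨h4, h5, h6⟩, h7⟩
    have h8 : θ ω ≤ Φ - Θ := by
      rcases h7 with h7 | h7 <;> linarith
    rcases h4 with h4 | h4
    · exact Or.inr ⟨h4, h6, h8⟩
    · exact Or.inl ⟨lt_of_le_of_ne h5 h1.symm, by linarith, h8⟩
  · rintro (⟨h4, h5, h6⟩ | ⟨h4, h5, h6⟩)
    · have h7 := lt_of_le_of_ne h5 h2
      have h8 := lt_of_le_of_ne h6 h3
      exact ⟨⟨Or.inr (by linarith), h4.le, by linarith⟩, Or.inl (by linarith)⟩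
    · have h8 := lt_of_le_of_ne h6 h3
      exact ⟨⟨Or.inl h4, by linarith, h5⟩, Or.inl (by linarith)⟩
end

section
/- Let θ be an atomless real random variable with cdf F_θ, let Θ > 0, Φ ≥ 0, and let z₂ be a real with 0 ≤ z₂ ≤ Θ. Then 𝒫(z₂ < |Φ − θ| ≤ Θ and |θ| > Θ) = ∇(Φ−Θ, Φ−z₂, Θ, Φ) + Δ(max(Φ+z₂, Θ), Φ+Θ). [Appendix B, Case 3: formula for P₃] -/
open MeasureTheory

theorem aux_Ioc {Ω : Type*} [MeasurableSpace Ω] (ℙ : Measure Ω) [IsProbabilityMeasure ℙ]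
    (θ : Ω → ℝ) (hθ : Measurable θ)
    (F : ℝ → ℝ) (hF : ∀ t : ℝ, F t = (ℙ {ω | θ ω ≤ t}).toReal) (a b : ℝ) :
    ℙ.real {ω | a < θ ω ∧ θ ω ≤ b} = if a ≤ b then F b - F a else 0 := by
  split_ifs with h
  · have hs : {ω | a < θ ω ∧ θ ω ≤ b} = {ω | θ ω ≤ b} \ {ω | θ ω ≤ a} := by
      ext ω
      simp only [Set.mem_ofPred_eq, Set.mem_sdiff, not_le]
      tauto
    have hsub : {ω | θ ω ≤ a} ⊆ {ω | θ ω ≤ b} := fun ω hω => le_trans hω h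
    rw [hs, measureReal_sdiff hsub
      (measurableSet_le hθ measurable_const), hF, hF]
    rfl
  · have hs : {ω | a < θ ω ∧ θ ω ≤ b} = ∅ := by
      ext ω
      simp only [Set.mem_ofPred_eq, Set.mem_empty_iff_false, iff_false]
      rintro ⟨h1, h2⟩
      linarith
    rw [hs]
    simp

/-- **Appendix B, Case 3.** Formula for `P₃`. -/
theorem stmt_4 {Ω : Type*} [MeasurableSpace Ω] (ℙ : Measure Ω) [IsProbabilityMeasure ℙ]
    (θ : Ω → ℝ) (hθ : Measurable θ)
    (hatomless : ∀ t : ℝ, ℙ {ω | θ ω = t} = 0)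
    (F : ℝ → ℝ) (hF : ∀ t : ℝ, F t = (ℙ {ω | θ ω ≤ t}).toReal)
    (Θ Φ z₂ : ℝ) (hΘ : 0 < Θ) (hΦ : 0 ≤ Φ)
    (hz₂₀ : 0 ≤ z₂) (hz₂₁ : z₂ ≤ Θ) :
    (ℙ {ω | (z₂ < |Φ - θ ω| ∧ |Φ - θ ω| ≤ Θ) ∧ Θ < |θ ω|}).toReal =
      Nabla F (Φ - Θ) (Φ - z₂) Θ Φ + Delta F (max (Φ + z₂) Θ) (Φ + Θ) := by
  have hN : Nabla F (Φ - Θ) (Φ - z₂) Θ Φ =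
      ℙ.real {ω | max (Φ - Θ) Θ < θ ω ∧ θ ω ≤ Φ - z₂} := by
    rw [aux_Ioc ℙ θ hθ F hF, Nabla, min_eq_left (by linarith : Φ - z₂ ≤ Φ)]
    refine if_congr ⟨fun h => h.2.2, fun h => ⟨by linarith, ?_, h⟩⟩ rfl rfl
    have := le_trans (le_max_right (Φ - Θ) Θ) h
    linarith
  have hD : Delta F (max (Φ + z₂) Θ) (Φ + Θ) =
      ℙ.real {ω | max (Φ + z₂) Θ < θ ω ∧ θ ω ≤ Φ + Θ} := by
    rw [aux_Ioc ℙ θ hθ F hF, Delta]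
  rw [hN, hD, ← measureReal_union]
  · refine measureReal_congr ?_
    have h1 : ∀ᵐ ω ∂ℙ, θ ω ≠ Φ - Θ := by
      rw [ae_iff]; simpa using hatomless (Φ - Θ)
    have h2 : ∀ᵐ ω ∂ℙ, θ ω ≠ Φ - z₂ := by
      rw [ae_iff]; simpa using hatomless (Φ - z₂)
    filter_upwards [h1, h2] with ω h1 h2
    apply propext
    change ((z₂ < |Φ - θ ω| ∧ |Φ - θ ω| ≤ Θ) ∧ Θ < |θ ω|) ↔
      ((max (Φ - Θ) Θ < θ ω ∧ θ ω ≤ Φ - z₂) ∨ (max (Φ + z₂) Θ < θ ω ∧ θ ω ≤ Φ + Θ))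
    rw [lt_abs, abs_le, lt_abs, max_lt_iff, max_lt_iff]
    generalize θ ω = t at *
    constructor
    · rintro ⟨⟨h3 | h3, h4, h5⟩, h6 | h6⟩
      · exact Or.inl ⟨⟨lt_of_le_of_ne (by linarith) h1.symm, h6⟩, by linarith⟩
      · linarith
      · exact Or.inr ⟨⟨by linarith, h6⟩, by linarith⟩
      · linarith
    · rintro (⟨⟨h3, h4⟩, h5⟩ | ⟨⟨h3, h4⟩, h5⟩)
      · have := lt_of_le_of_ne h5 h2
        exact ⟨⟨Or.inl (by linarith), by linarith, by linarith⟩, Or.inl h4⟩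
      · exact ⟨⟨Or.inr (by linarith), by linarith, by linarith⟩, Or.inl h4⟩
  · rw [Set.disjoint_left]
    rintro ω ⟨_, h1⟩ ⟨h2, _⟩
    have := lt_of_le_of_lt (le_max_left _ _) h2
    linarith
  · exact (measurableSet_lt measurable_const hθ).inter (measurableSet_le hθ measurable_const)
end

section
/- Let θ be an atomless real random variable with cdf F_θ, let Θ > 0, Φ ≥ 0, let z₁, z₂ be reals with 0 ≤ z₁ ≤ Θ and 0 ≤ z₂ ≤ Θ, and assume additionally 𝒫(0 < θ < Φ) = 1. Then: (i) 𝒫(z₁ < |θ| ≤ Θ and z₂ < |Φ − θ| ≤ Θ) = ∇(z₁, Θ, max(0, Φ−Θ), Φ−z₂); (ii) 𝒫(z₁ < |θ| ≤ Θ and |Φ − θ| > Θ) = Δ(z₁, min(Θ, Φ−Θ)); (iii) 𝒫(z₂ < |Φ − θ| ≤ Θ and |θ| > Θ) = ∇(Φ−Θ, Φ−z₂, Θ, Φ); (iv) 𝒫(|θ| > Θ and |Φ − θ| > Θ) = Δ(Θ, Φ−Θ). [Remark 1: simplified cdf terms when both incidence angles are nonnegative] -/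
open MeasureTheory

theorem aux_ioc {Ω : Type*} [MeasurableSpace Ω] (ℙ : Measure Ω) [IsProbabilityMeasure ℙ]
    (θ : Ω → ℝ) (hθ : Measurable θ)
    (F : ℝ → ℝ) (hF : ∀ t : ℝ, F t = (ℙ {ω | θ ω ≤ t}).toReal) (a b : ℝ) (p : Ω → Prop)
    (h : ∀ᵐ ω ∂ℙ, p ω ↔ (a < θ ω ∧ θ ω ≤ b)) :
    (ℙ {ω | p ω}).toReal = if a ≤ b then F b - F a else 0 := by
  have h1 : ℙ {ω | p ω} = ℙ {ω | a < θ ω ∧ θ ω ≤ b} := by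
    apply measure_congr
    filter_upwards [h] with ω hω
    exact propext hω
  rw [h1]
  split_ifs with hab
  · have h2 : {ω | a < θ ω ∧ θ ω ≤ b} = {ω | θ ω ≤ b} \ {ω | θ ω ≤ a} := by
      ext ω
      simp [and_comm]
    have hs : {ω | θ ω ≤ a} ⊆ {ω | θ ω ≤ b} := fun ω hω => le_trans hω hab
    rw [h2, hF, hF]
    exact measureReal_diff hs (measurableSet_le hθ measurable_const)
  · have h2 : {ω | a < θ ω ∧ θ ω ≤ b} = ∅ := by
      ext ω
      simp only [Set.mem_setOf_eq, Set.mem_empty_iff_false, iff_false]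
      intro hh
      exact hab (hh.1.le.trans hh.2)
    simp [h2]

/-- **Remark 1.** Simplified cdf terms when both incidence angles are nonnegative. -/
theorem stmt_13 {Ω : Type*} [MeasurableSpace Ω] (ℙ : Measure Ω) [IsProbabilityMeasure ℙ]
    (θ : Ω → ℝ) (hθ : Measurable θ)
    (hatomless : ∀ t : ℝ, ℙ {ω | θ ω = t} = 0)
    (F : ℝ → ℝ) (hF : ∀ t : ℝ, F t = (ℙ {ω | θ ω ≤ t}).toReal)
    (Θ Φ z₁ z₂ : ℝ) (hΘ : 0 < Θ) (hΦ : 0 ≤ Φ)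
    (hz₁₀ : 0 ≤ z₁) (hz₁₁ : z₁ ≤ Θ) (hz₂₀ : 0 ≤ z₂) (hz₂₁ : z₂ ≤ Θ)
    (hsupp : ℙ {ω | 0 < θ ω ∧ θ ω < Φ} = 1) :
    (ℙ {ω | (z₁ < |θ ω| ∧ |θ ω| ≤ Θ) ∧ (z₂ < |Φ - θ ω| ∧ |Φ - θ ω| ≤ Θ)}).toReal =
        Nabla F z₁ Θ (max 0 (Φ - Θ)) (Φ - z₂) ∧
    (ℙ {ω | (z₁ < |θ ω| ∧ |θ ω| ≤ Θ) ∧ Θ < |Φ - θ ω|}).toReal =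
        Delta F z₁ (min Θ (Φ - Θ)) ∧
    (ℙ {ω | (z₂ < |Φ - θ ω| ∧ |Φ - θ ω| ≤ Θ) ∧ Θ < |θ ω|}).toReal =
        Nabla F (Φ - Θ) (Φ - z₂) Θ Φ ∧
    (ℙ {ω | Θ < |θ ω| ∧ Θ < |Φ - θ ω|}).toReal = Delta F Θ (Φ - Θ) := by
  have hs : ∀ᵐ ω ∂ℙ, 0 < θ ω ∧ θ ω < Φ := by
    rw [← prob_compl_eq_zero_iff] at hsupp
    · exact hsupp
    · exact (measurableSet_lt measurable_const hθ).inter (measurableSet_lt hθ measurable_const)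
  have hne : ∀ t : ℝ, ∀ᵐ ω ∂ℙ, θ ω ≠ t := fun t => by
    rw [ae_iff]
    simpa using hatomless t
  have key : ∀ (a b : ℝ) (p : Ω → Prop),
      (∀ ω, 0 < θ ω → θ ω < Φ → θ ω ≠ Φ - Θ → θ ω ≠ Φ - z₂ →
        |θ ω| = θ ω → |Φ - θ ω| = Φ - θ ω → (p ω ↔ (a < θ ω ∧ θ ω ≤ b))) →
      (ℙ {ω | p ω}).toReal = if a ≤ b then F b - F a else 0 := by
    intro a b p hp
    apply aux_ioc ℙ θ hθ F hF
    filter_upwards [hs, hne (Φ - Θ), hne (Φ - z₂)] with ω h1 h2 h3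
    exact hp ω h1.1 h1.2 h2 h3 (abs_of_pos h1.1) (abs_of_pos (by linarith [h1.2]))
  refine ⟨?_, ?_, ?_, ?_⟩
  · have hN : Nabla F z₁ Θ (max 0 (Φ - Θ)) (Φ - z₂) =
        if max z₁ (max 0 (Φ - Θ)) ≤ min Θ (Φ - z₂) then
          F (min Θ (Φ - z₂)) - F (max z₁ (max 0 (Φ - Θ))) else 0 := by
      unfold Nabla
      refine if_congr ⟨fun h => h.2.2, fun h => ⟨hz₁₁, ?_, h⟩⟩ rfl rfl
      exact (le_max_right _ _).trans (h.trans (min_le_right _ _))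
    rw [hN]
    apply key
    intro ω h1 h2 h3 h4 h5 h6
    rw [h5, h6, max_lt_iff, max_lt_iff, le_min_iff]
    grind
  · unfold Delta
    apply key
    intro ω h1 h2 h3 h4 h5 h6
    rw [h5, h6, le_min_iff]
    grind
  · have hN : Nabla F (Φ - Θ) (Φ - z₂) Θ Φ =
        if max (Φ - Θ) Θ ≤ min (Φ - z₂) Φ then
          F (min (Φ - z₂) Φ) - F (max (Φ - Θ) Θ) else 0 := by
      unfold Nabla
      refine if_congr ⟨fun h => h.2.2, fun h => ⟨by linarith, ?_, h⟩⟩ rfl rfl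
      exact (le_max_right _ _).trans (h.trans (min_le_right _ _))
    rw [hN]
    apply key
    intro ω h1 h2 h3 h4 h5 h6
    rw [h5, h6, max_lt_iff, le_min_iff]
    grind
  · unfold Delta
    apply key
    intro ω h1 h2 h3 h4 h5 h6
    rw [h5, h6]
    grind
end

section
/- Let θ be an atomless real random variable with cdf F_θ, let Φ ≥ 0, and let z₁, z₂ be reals with z₁ ≥ 0 and z₂ ≥ 0. Then 𝒫(|θ| > z₁ and |Φ − θ| > z₂) = Δ(z₁, Φ−z₂) + F_θ(min(−z₁, Φ−z₂)) + 1 − F_θ(max(z₁, Φ+z₂)). [Remark 2: simplified cdf of the two-LED effective channel under wide FOV] -/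
open MeasureTheory

/-- **Remark 2.** Simplified cdf of the two-LED effective channel under wide FOV. -/
theorem stmt_14 {Ω : Type*} [MeasurableSpace Ω] (ℙ : Measure Ω) [IsProbabilityMeasure ℙ]
    (θ : Ω → ℝ) (hθ : Measurable θ)
    (hatomless : ∀ t : ℝ, ℙ {ω | θ ω = t} = 0)
    (F : ℝ → ℝ) (hF : ∀ t : ℝ, F t = (ℙ {ω | θ ω ≤ t}).toReal)
    (Φ z₁ z₂ : ℝ) (hΦ : 0 ≤ Φ) (hz₁ : 0 ≤ z₁) (hz₂ : 0 ≤ z₂) :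
    (ℙ {ω | z₁ < |θ ω| ∧ z₂ < |Φ - θ ω|}).toReal =
      Delta F z₁ (Φ - z₂) + F (min (-z₁) (Φ - z₂)) + 1 - F (max z₁ (Φ + z₂)) := by
  have hle : ∀ t : ℝ, MeasurableSet {ω | θ ω ≤ t} := fun t => measurableSet_le hθ measurable_const
  have hlt : ∀ t : ℝ, MeasurableSet {ω | θ ω < t} := fun t => measurableSet_lt hθ measurable_const
  have hgt : ∀ t : ℝ, MeasurableSet {ω | t < θ ω} := fun t => measurableSet_lt measurable_const hθ
  have hF' : ∀ t : ℝ, F t = ℙ.real {ω | θ ω ≤ t} := hF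
  have hFlt : ∀ t : ℝ, ℙ.real {ω | θ ω < t} = F t := by
    intro t
    have h1 : {ω | θ ω ≤ t} = {ω | θ ω < t} ∪ {ω | θ ω = t} := by
      ext ω
      simp only [Set.mem_ofPred_eq, Set.mem_union, le_iff_lt_or_eq]
    rw [hF', h1, measureReal_union _ (measurableSet_eq_fun hθ measurable_const)]
    · simp [Measure.real, hatomless t]
    · rw [Set.disjoint_left]
      intro ω h2 h3
      simp only [Set.mem_ofPred_eq] at h2 h3
      linarith
  have hFgt : ∀ t : ℝ, ℙ.real {ω | t < θ ω} = 1 - F t := by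
    intro t
    have h1 : {ω | t < θ ω} = {ω | θ ω ≤ t}ᶜ := by
      ext ω
      simp
    rw [h1, probReal_compl_eq_one_sub (hle t), hF']
  have hD : ∀ a b : ℝ, ℙ.real {ω | a < θ ω ∧ θ ω < b} = Delta F a b := by
    intro a b
    unfold Delta
    split_ifs with h
    · rcases h.eq_or_lt with h | h
      · subst h
        have : {ω | a < θ ω ∧ θ ω < a} = ∅ := by
          ext ω
          simp only [Set.mem_ofPred_eq, Set.mem_empty_iff_false, iff_false]
          intro h
          linarith [h.1, h.2]
        simp [this]
      · have h1 : {ω | a < θ ω ∧ θ ω < b} = {ω | θ ω < b} \ {ω | θ ω ≤ a} := by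
          ext ω
          simp [and_comm]
        have h2 : {ω | θ ω ≤ a} ⊆ {ω | θ ω < b} := by
          intro ω hω
          simp only [Set.mem_ofPred_eq] at hω ⊢
          linarith
        rw [h1, measureReal_sdiff h2 (hle a), hFlt, hF' a]
    · have : {ω | a < θ ω ∧ θ ω < b} = ∅ := by
        ext ω
        simp only [Set.mem_ofPred_eq, Set.mem_empty_iff_false, iff_false]
        intro h
        linarith [h.1, h.2]
      simp [this]
  have hS : {ω | z₁ < |θ ω| ∧ z₂ < |Φ - θ ω|} =
      ({ω | z₁ < θ ω ∧ θ ω < Φ - z₂} ∪ {ω | θ ω < min (-z₁) (Φ - z₂)}) ∪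
        {ω | max z₁ (Φ + z₂) < θ ω} := by
    ext ω
    simp only [Set.mem_ofPred_eq, Set.mem_union, lt_abs, lt_min_iff, max_lt_iff]
    constructor
    · rintro ⟨h1 | h1, h2 | h2⟩
      · exact Or.inl (Or.inl ⟨h1, by linarith⟩)
      · exact Or.inr ⟨h1, by linarith⟩
      · exact Or.inl (Or.inr ⟨by linarith, by linarith⟩)
      · linarith
    · rintro ((⟨h1, h2⟩ | ⟨h1, h2⟩) | ⟨h1, h2⟩)
      · exact ⟨Or.inl h1, Or.inl (by linarith)⟩
      · exact ⟨Or.inr (by linarith), Or.inl (by linarith)⟩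
      · exact ⟨Or.inl h1, Or.inr (by linarith)⟩
  change ℙ.real _ = _
  rw [hS, measureReal_union _ (hgt _), measureReal_union _ (hlt _), hD, hFlt, hFgt]
  · ring
  · rw [Set.disjoint_left]
    intro ω h2 h3
    simp only [Set.mem_ofPred_eq, lt_min_iff] at h2 h3
    linarith [h2.1, h3.1]
  · rw [Set.disjoint_left]
    intro ω h2 h3
    simp only [Set.mem_ofPred_eq, Set.mem_union, lt_min_iff, max_lt_iff] at h2 h3
    rcases h2 with h2 | h2
    · linarith [h2.2, h3.2]
    · linarith [h2.1, h3.1]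
end
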